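/- Gondran–Minoux theorem: for an n×n matrix A over R_max, the bideterminant satisfies |A|⁺ = |A|⁻ if and only if the columns of A are linearly dependent in the Gondran–Minoux sense, i.e., there exist a partition of {1,...,n} into disjoint sets I, J and scalars α_1,...,α_n ∈ R_max not all equal to -∞ such that ⊕_{i∈I} α_i ⊙ A_i = ⊕_{j∈J} α_j ⊙ A_j, where A_k denotes the k-th column. -/

import Mathlib

open scoped Classical

noncomputable section

/-- Positive determinant over `R_max = (ℝ ∪ {-∞}, max, +)` (modelled by `WithBot ℝ`):
maximum over even permutations `σ` of `Σ_i a_{iσ(i)}` (empty max is `-∞`). -/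
def detp {n : ℕ} (A : Matrix (Fin n) (Fin n) (WithBot ℝ)) : WithBot ℝ :=
  (Finset.univ.filter fun σ : Equiv.Perm (Fin n) => Equiv.Perm.sign σ = 1).sup
    fun σ => ∑ i, A i (σ i)

/-- Negative determinant over `R_max`: maximum over odd permutations. -/
def detm {n : ℕ} (A : Matrix (Fin n) (Fin n) (WithBot ℝ)) : WithBot ℝ :=
  (Finset.univ.filter fun σ : Equiv.Perm (Fin n) => Equiv.Perm.sign σ = -1).sup
    fun σ => ∑ i, A i (σ i)

/-- The ordered field of Hahn series used for lifting. -/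
abbrev GMK0 : Type := Lex (HahnSeries ℝ ℝ)

/-- Valuation. -/
def gmw0 (x : GMK0) : WithBot ℝ := if x = 0 then ⊥ else ((-(ofLex x).order : ℝ) : WithBot ℝ)

/-- Section of the valuation. -/
def gmT0 : WithBot ℝ → GMK0
  | ⊥ => 0
  | (a : ℝ) => toLex (HahnSeries.single (-a) 1)

lemma gmw0_zero : gmw0 0 = ⊥ := by simp [gmw0]

lemma gmw0_eq_bot {x : GMK0} : gmw0 x = ⊥ ↔ x = 0 := by
  unfold gmw0; split_ifs with h <;> simp [h]

lemma gmw0_mul (x y : GMK0) : gmw0 (x * y) = gmw0 x + gmw0 y := by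
  unfold gmw0
  by_cases hx : x = 0
  · simp [hx]
  by_cases hy : y = 0
  · simp [hy]
  have : (ofLex (x * y)).order = (ofLex x).order + (ofLex y).order := by
    rw [ofLex_mul]
    exact HahnSeries.order_mul (by simpa using hx) (by simpa using hy)
  rw [if_neg hx, if_neg hy, if_neg (mul_ne_zero hx hy), this, ← WithBot.coe_add]
  congr 1; ring

lemma gmw0_mono {x y : GMK0} (hx : 0 ≤ x) (hxy : x ≤ y) : gmw0 x ≤ gmw0 y := by
  by_cases hx0 : x = 0
  · simp [hx0, gmw0_zero]
  have hxp : 0 < x := lt_of_le_of_ne hx (Ne.symm hx0)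
  have hyp : 0 < y := hxp.trans_le hxy
  have hy0 := hyp.ne'
  unfold gmw0
  rw [if_neg hx0, if_neg hy0, WithBot.coe_le_coe, neg_le_neg_iff]
  by_contra h
  push Not at h
  have : |y| < |x| := by
    apply HahnSeries.abs_lt_abs_of_orderTop_ofLex
    rw [← HahnSeries.order_eq_orderTop_of_ne_zero (by simpa using hx0),
      ← HahnSeries.order_eq_orderTop_of_ne_zero (by simpa using hy0)]
    exact_mod_cast h
  rw [abs_of_pos hxp, abs_of_pos hyp] at this
  exact absurd this (not_lt.mpr hxy)

lemma gmw0_nat (n : ℕ) (hn : n ≠ 0) : gmw0 (n : GMK0) = 0 := by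
  have h : (ofLex (n : GMK0)) = HahnSeries.C (n : ℝ) := by
    exact (map_natCast (HahnSeries.C : ℝ →+* HahnSeries ℝ ℝ) n).symm
  have h0 : (n : GMK0) ≠ 0 := by exact_mod_cast hn
  unfold gmw0
  rw [if_neg h0, h, HahnSeries.order_C]
  simp

lemma gmw0_neg (x : GMK0) : gmw0 (-x) = gmw0 x := by
  unfold gmw0
  simp

lemma gmT0_bot : gmT0 ⊥ = 0 := rfl

lemma gmT0_pos (a : ℝ) : 0 < gmT0 a := by
  rw [← HahnSeries.leadingCoeff_pos_iff]
  simp [gmT0]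

lemma gmT0_nonneg (a : WithBot ℝ) : 0 ≤ gmT0 a := by
  induction a with
  | bot => exact le_rfl
  | coe a => exact (gmT0_pos a).le

lemma gmw0_gmT0 (a : WithBot ℝ) : gmw0 (gmT0 a) = a := by
  induction a with
  | bot => exact gmw0_zero
  | coe a =>
    unfold gmw0
    rw [if_neg (gmT0_pos a).ne']
    simp [gmT0, HahnSeries.order_single]

lemma gmT0_zero : gmT0 0 = 1 := by
  change toLex (HahnSeries.single (-(0:ℝ)) (1:ℝ)) = 1
  rw [neg_zero]; rfl

lemma gmT0_add (a b : WithBot ℝ) : gmT0 (a + b) = gmT0 a * gmT0 b := by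
  induction a with
  | bot => simp [gmT0_bot]
  | coe a =>
    induction b with
    | bot => simp [gmT0_bot]
    | coe b =>
      rw [← WithBot.coe_add]
      change toLex (HahnSeries.single (-(a + b)) (1:ℝ)) =
        toLex (HahnSeries.single (-a) (1:ℝ) * HahnSeries.single (-b) (1:ℝ))
      rw [HahnSeries.single_mul_single, mul_one, neg_add]

/-- The same field, with opaque-looking instances. -/
def GMK : Type := GMK0

instance : Field GMK := inferInstanceAs (Field GMK0)

instance : LinearOrder GMK := inferInstanceAs (LinearOrder GMK0)

instance : IsStrictOrderedRing GMK := inferInstanceAs (IsStrictOrderedRing GMK0)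

/-- Valuation. -/
def gmw (x : GMK) : WithBot ℝ := gmw0 x

/-- Section of the valuation. -/
def gmT (a : WithBot ℝ) : GMK := gmT0 a

lemma gmw_zero : gmw 0 = ⊥ := gmw0_zero

lemma gmw_eq_bot {x : GMK} : gmw x = ⊥ ↔ x = 0 := gmw0_eq_bot

lemma gmw_mul (x y : GMK) : gmw (x * y) = gmw x + gmw y := gmw0_mul x y

lemma gmw_mono {x y : GMK} (hx : 0 ≤ x) (hxy : x ≤ y) : gmw x ≤ gmw y := gmw0_mono hx hxy

lemma gmw_nat (n : ℕ) (hn : n ≠ 0) : gmw (n : GMK) = 0 := gmw0_nat n hn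

lemma gmw_neg (x : GMK) : gmw (-x) = gmw x := gmw0_neg x

lemma gmT_bot : gmT ⊥ = 0 := rfl

lemma gmT_nonneg (a : WithBot ℝ) : 0 ≤ gmT a := gmT0_nonneg a

lemma gmw_gmT (a : WithBot ℝ) : gmw (gmT a) = a := gmw0_gmT0 a

lemma gmT_zero : gmT 0 = 1 := gmT0_zero

lemma gmT_add (a b : WithBot ℝ) : gmT (a + b) = gmT a * gmT b := gmT0_add a b

lemma gmw_add {x y : GMK} (hx : 0 ≤ x) (hy : 0 ≤ y) : gmw (x + y) = gmw x ⊔ gmw y := by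
  have key : ∀ {x y : GMK}, 0 ≤ x → x ≤ y → gmw (x + y) ≤ gmw y := by
    intro x y hx hxy
    calc gmw (x + y) ≤ gmw (((2 : ℕ) : GMK) * y) := by
          apply gmw_mono (by linarith)
          push_cast; linarith
      _ = gmw y := by rw [gmw_mul, gmw_nat 2 (by norm_num), zero_add]
  apply le_antisymm
  · rcases le_total x y with h | h
    · exact (key hx h).trans le_sup_right
    · rw [add_comm]; exact (key hy h).trans le_sup_left
  · exact sup_le (gmw_mono hx (by linarith)) (gmw_mono hy (by linarith))

lemma gmw_sum {ι : Type*} (s : Finset ι) (f : ι → GMK) (hf : ∀ i ∈ s, 0 ≤ f i) :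
    gmw (∑ i ∈ s, f i) = s.sup fun i => gmw (f i) := by
  induction s using Finset.induction_on with
  | empty => simp [gmw_zero]
  | insert a s ha ih =>
    rw [Finset.sum_insert ha, Finset.sup_insert, gmw_add (hf a (by simp))
      (Finset.sum_nonneg fun i hi => hf i (by simp [hi])), ih fun i hi => hf i (by simp [hi])]

lemma gmT_mono {a b : WithBot ℝ} (h : a ≤ b) : gmT a ≤ gmT b := by
  by_contra hc
  push Not at hc
  have := gmw_mono (gmT_nonneg b) hc.le
  rw [gmw_gmT, gmw_gmT] at this
  rw [le_antisymm h this] at hc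
  exact lt_irrefl _ hc

lemma gmT_sum {ι : Type*} (s : Finset ι) (f : ι → WithBot ℝ) :
    gmT (∑ i ∈ s, f i) = ∏ i ∈ s, gmT (f i) := by
  induction s using Finset.induction_on with
  | empty => simp [gmT_zero]
  | insert a s ha ih => rw [Finset.sum_insert ha, Finset.prod_insert ha, gmT_add, ih]

lemma gm_sum_nonneg {ι : Type*} [Fintype ι] (σ : ι) (f : ι → GMK) (h0 : 0 ≤ f σ)
    (h : ∀ τ, τ ≠ σ → -(f σ) ≤ (Fintype.card ι : GMK) * f τ) : 0 ≤ ∑ τ, f τ := by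
  have hL : (0 : GMK) < (Fintype.card ι : GMK) := by
    exact_mod_cast Fintype.card_pos_iff.mpr ⟨σ⟩
  have h1 : (Fintype.card ι : GMK) * f σ + f σ ≤
      ∑ τ, ((Fintype.card ι : GMK) * f τ + f σ) := by
    apply Finset.single_le_sum (f := fun τ => (Fintype.card ι : GMK) * f τ + f σ) _
      (Finset.mem_univ σ)
    intro τ _
    by_cases ht : τ = σ
    · subst ht; positivity
    · have := h τ ht
      change 0 ≤ (Fintype.card ι : GMK) * f τ + f σ
      linarith
  rw [Finset.sum_add_distrib, ← Finset.mul_sum, Finset.sum_const, Finset.card_univ,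
    nsmul_eq_mul] at h1
  have : 0 ≤ (Fintype.card ι : GMK) * ∑ τ, f τ := by linarith
  exact nonneg_of_mul_nonneg_right this hL

lemma gm_lift {n : ℕ} (A : Matrix (Fin n) (Fin n) (WithBot ℝ)) (σ : Equiv.Perm (Fin n))
    (hσ : ∀ τ : Equiv.Perm (Fin n), ∑ i, A i (τ i) ≤ ∑ i, A i (σ i)) :
    ∃ M : Matrix (Fin n) (Fin n) GMK, (∀ i j, 0 ≤ M i j ∧ gmw (M i j) = A i j) ∧
      0 ≤ ((Equiv.Perm.sign σ : ℤ) : GMK) * M.det := by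
  set N := Fintype.card (Equiv.Perm (Fin n)) with hN
  have hN0 : N ≠ 0 := Fintype.card_ne_zero
  have hN1 : (1 : GMK) ≤ N := by exact_mod_cast Nat.one_le_iff_ne_zero.mpr hN0
  have hNn : (0 : GMK) ≤ N := zero_le_one.trans hN1
  let g : Fin n → Fin n → GMK := fun i j => if j = σ i then (N : GMK) else 1
  have hg0 : ∀ i j, 0 ≤ g i j := by
    intro i j; dsimp only [g]; split_ifs; exacts [hNn, zero_le_one]
  have hgw : ∀ i j, gmw (g i j) = 0 := by
    intro i j; dsimp only [g]; split_ifs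
    · exact gmw_nat N hN0
    · exact_mod_cast gmw_nat 1 one_ne_zero
  refine ⟨Matrix.of fun i j => g i j * gmT (A i j), fun i j => ⟨mul_nonneg (hg0 i j) (gmT_nonneg _), ?_⟩, ?_⟩
  · rw [Matrix.of_apply, gmw_mul, hgw, zero_add, gmw_gmT]
  rw [← Matrix.det_transpose, Matrix.det_apply', Finset.mul_sum]
  have hP : ∀ τ : Equiv.Perm (Fin n), ∏ i, (g i (τ i) * gmT (A i (τ i))) =
      (∏ i, g i (τ i)) * gmT (∑ i, A i (τ i)) := by
    intro τ; rw [Finset.prod_mul_distrib, gmT_sum]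
  have hs : ∀ τ : Equiv.Perm (Fin n), ((Equiv.Perm.sign σ : ℤ) : GMK) *
      (((Equiv.Perm.sign τ : ℤ) : GMK) * ∏ i, (Matrix.of
        (fun i j => g i j * gmT (A i j))).transpose (τ i) i) =
      (((Equiv.Perm.sign σ : ℤ) : GMK) * ((Equiv.Perm.sign τ : ℤ) : GMK)) *
      ((∏ i, g i (τ i)) * gmT (∑ i, A i (τ i))) := by
    intro τ
    rw [← hP, mul_assoc]; rfl
  simp_rw [hs]
  have hss : ((Equiv.Perm.sign σ : ℤ) : GMK) * ((Equiv.Perm.sign σ : ℤ) : GMK) = 1 := by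
    rcases Int.units_eq_one_or (Equiv.Perm.sign σ) with h | h <;> simp [h]
  have hgσ : ∏ i, g i (σ i) = (N : GMK) ^ n := by simp [g]
  apply gm_sum_nonneg σ
  · rw [hss, one_mul]
    exact mul_nonneg (Finset.prod_nonneg fun i _ => hg0 _ _) (gmT_nonneg _)
  · intro τ hτ
    rw [hss, one_mul, hgσ]
    obtain ⟨i0, hi0⟩ : ∃ i, τ i ≠ σ i := by
      by_contra hc; push Not at hc; exact hτ (Equiv.ext hc)
    have hb : (N : GMK) * ∏ i, g i (τ i) ≤ (N : GMK) ^ n := by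
      have h1 : (N : GMK) = ∏ i, (if i = i0 then (N : GMK) else 1) := by simp
      calc (N : GMK) * ∏ i, g i (τ i)
          = (∏ i, (if i = i0 then (N : GMK) else 1)) * ∏ i, g i (τ i) := by rw [← h1]
        _ = ∏ i, ((if i = i0 then (N : GMK) else 1) * g i (τ i)) := by
            rw [Finset.prod_mul_distrib]
        _ ≤ ∏ i : Fin n, (N : GMK) := by
            apply Finset.prod_le_prod
            · intro i _
              apply mul_nonneg _ (hg0 _ _)
              split_ifs; exacts [hNn, zero_le_one]
            · intro i _
              by_cases h : i = i0
              · subst h; simp [g, hi0]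
              · rw [if_neg h, one_mul]; dsimp only [g]; split_ifs; exacts [le_rfl, hN1]
        _ = (N : GMK) ^ n := by simp
    have hb2 : (N : GMK) * ((∏ i, g i (τ i)) * gmT (∑ i, A i (τ i))) ≤
        (N : GMK) ^ n * gmT (∑ i, A i (σ i)) := by
      rw [← mul_assoc]
      exact mul_le_mul hb (gmT_mono (hσ τ)) (gmT_nonneg _) (pow_nonneg hNn n)
    have hpos : 0 ≤ (N : GMK) * ((∏ i, g i (τ i)) * gmT (∑ i, A i (τ i))) :=
      mul_nonneg hNn (mul_nonneg (Finset.prod_nonneg fun i _ => hg0 _ _) (gmT_nonneg _))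
    set P := (∏ i, g i (τ i)) * gmT (∑ i, A i (τ i))
    rcases Int.units_eq_one_or (Equiv.Perm.sign σ) with h | h <;>
    rcases Int.units_eq_one_or (Equiv.Perm.sign τ) with h' | h' <;>
    simp only [h, h', Units.val_one, Units.val_neg, Int.cast_one, Int.cast_neg, one_mul, mul_one,
      mul_neg, neg_mul, neg_neg] <;> linarith

lemma gm_convex {a : WithBot ℝ} {x y p q : GMK} (hx : 0 ≤ x) (hy : 0 ≤ y) (hwx : gmw x = a)
    (hwy : gmw y = a) (hp : 0 ≤ p) (hq : 0 ≤ q) (hpq : p + q = 1) :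
    0 ≤ p * x + q * y ∧ gmw (p * x + q * y) = a := by
  wlog h : x ≤ y generalizing x y p q
  · have := this hy hx hwy hwx hq hp (by rw [add_comm, hpq]) (le_of_not_ge h)
    rwa [add_comm (q * y)] at this
  have hp' : p = 1 - q := by linarith
  have h1 : x ≤ p * x + q * y := by
    have := mul_nonneg hq (sub_nonneg.mpr h)
    subst hp'; linarith [mul_sub q y x, sub_mul 1 q x]
  have h2 : p * x + q * y ≤ y := by
    have := mul_nonneg hp (sub_nonneg.mpr h)
    have hq' : q = 1 - p := by linarith
    subst hq'; linarith [mul_sub p y x, sub_mul 1 p y]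
  refine ⟨hx.trans h1, le_antisymm ?_ ?_⟩
  · rw [← hwy]; exact gmw_mono (hx.trans h1) h2
  · rw [← hwx]; exact gmw_mono hx h1

lemma gm_zero_det {n : ℕ} (A : Matrix (Fin n) (Fin n) (WithBot ℝ))
    (M N : Matrix (Fin n) (Fin n) GMK) (hM : ∀ i j, 0 ≤ M i j ∧ gmw (M i j) = A i j)
    (hN : ∀ i j, 0 ≤ N i j ∧ gmw (N i j) = A i j) (hMd : 0 ≤ M.det) (hNd : N.det ≤ 0) :
    ∃ P : Matrix (Fin n) (Fin n) GMK, (∀ i j, 0 ≤ P i j ∧ gmw (P i j) = A i j) ∧ P.det = 0 := by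
  by_contra hc
  push Not at hc
  have key : ∀ s : Finset (Fin n), ∃ Q : Matrix (Fin n) (Fin n) GMK,
      (∀ i ∈ s, Q i = N i) ∧ (∀ i j, 0 ≤ Q i j ∧ gmw (Q i j) = A i j) ∧ 0 ≤ Q.det := by
    intro s
    induction s using Finset.induction_on with
    | empty => exact ⟨M, by simp, hM, hMd⟩
    | insert a s ha ih =>
      obtain ⟨Q, hQs, hQ, hQd⟩ := ih
      have hup : ∀ r : Fin n → GMK, (∀ j, 0 ≤ r j ∧ gmw (r j) = A a j) →
          ∀ i j, 0 ≤ Q.updateRow a r i j ∧ gmw (Q.updateRow a r i j) = A i j := by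
        intro r hr i j
        by_cases h : i = a
        · subst h; simpa using hr j
        · rw [Matrix.updateRow_ne h]; exact hQ i j
      refine ⟨Q.updateRow a (N a), ?_, hup _ (hN a), ?_⟩
      · intro i hi
        by_cases h : i = a
        · subst h; simp
        · rw [Matrix.updateRow_ne h]
          exact hQs i (by simpa [h] using hi)
      · by_contra hneg
        push Not at hneg
        set d1 := Q.det with hd1
        set d2 := (Q.updateRow a (N a)).det with hd2
        have hpos : 0 < d1 - d2 := by linarith
        have hne := hpos.ne'
        let p := (-d2) / (d1 - d2)
        let q := d1 / (d1 - d2)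
        have hp : 0 ≤ p := div_nonneg (by linarith) hpos.le
        have hq : 0 ≤ q := div_nonneg hQd hpos.le
        have hpq : p + q = 1 := by
          dsimp only [p, q]; rw [← add_div, neg_add_eq_sub, div_self hne]
        refine hc (Q.updateRow a (p • Q a + q • N a)) (hup _ fun j => ?_) ?_
        · exact gm_convex (hQ a j).1 (hN a j).1 (hQ a j).2 (hN a j).2 hp hq hpq
        · rw [Matrix.det_updateRow_add, Matrix.det_updateRow_smul, Matrix.det_updateRow_smul,
            Matrix.updateRow_eq_self, ← hd1, ← hd2]
          dsimp only [p, q]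
          rw [div_mul_eq_mul_div, div_mul_eq_mul_div, ← add_div, neg_mul, mul_comm d2,
            neg_add_cancel, zero_div]
  obtain ⟨Q, hQN, hQ, hQd⟩ := key Finset.univ
  have : Q = N := funext fun i => hQN i (Finset.mem_univ i)
  exact hc Q hQ (le_antisymm (this ▸ hNd) hQd)

lemma gm_of_det_zero {n : ℕ} (A : Matrix (Fin n) (Fin n) (WithBot ℝ))
    (P : Matrix (Fin n) (Fin n) GMK) (hP : ∀ i j, 0 ≤ P i j ∧ gmw (P i j) = A i j)
    (hd : P.det = 0) :
    ∃ (I : Finset (Fin n)) (α : Fin n → WithBot ℝ),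
      (∃ k, α k ≠ ⊥) ∧
      ∀ i, (I.sup fun k => α k + A i k) = (Iᶜ.sup fun k => α k + A i k) := by
  obtain ⟨v, hv0, hv⟩ := Matrix.exists_mulVec_eq_zero_iff.mpr hd
  refine ⟨Finset.univ.filter fun k => 0 < v k, fun k => gmw (v k), ?_, fun i => ?_⟩
  · obtain ⟨k, hk⟩ := Function.ne_iff.mp hv0
    exact ⟨k, fun h => hk (gmw_eq_bot.mp h)⟩
  · set I := Finset.univ.filter fun k => 0 < v k with hI
    have h1 : ∑ k ∈ I, v k * P i k = ∑ k ∈ Iᶜ, (-(v k)) * P i k := by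
      have h := congrFun hv i
      rw [Matrix.mulVec, dotProduct, ← Finset.sum_add_sum_compl I] at h
      simp only [neg_mul, Finset.sum_neg_distrib]
      simp only [mul_comm (v _)]
      exact eq_neg_of_add_eq_zero_left h
    have h2 := congrArg gmw h1
    rw [gmw_sum, gmw_sum] at h2
    · simpa only [gmw_mul, gmw_neg, (hP _ _).2] using h2
    · intro k hk
      have : ¬ 0 < v k := by simpa [hI] using hk
      exact mul_nonneg (by linarith) (hP i k).1
    · intro k hk
      have : 0 < v k := by simpa [hI] using hk
      exact mul_nonneg this.le (hP i k).1

lemma gm_forward {n : ℕ} (A : Matrix (Fin n) (Fin n) (WithBot ℝ)) (h : detp A = detm A) :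
    ∃ (I : Finset (Fin n)) (α : Fin n → WithBot ℝ),
      (∃ k, α k ≠ ⊥) ∧
      ∀ i, (I.sup fun k => α k + A i k) = (Iᶜ.sup fun k => α k + A i k) := by
  have hle : ∀ τ : Equiv.Perm (Fin n), ∑ i, A i (τ i) ≤ detp A := by
    intro τ
    rcases Int.units_eq_one_or (Equiv.Perm.sign τ) with hs | hs
    · exact Finset.le_sup (f := fun σ : Equiv.Perm (Fin n) => ∑ i, A i (σ i)) (by simp [hs])
    · rw [h]
      exact Finset.le_sup (f := fun σ : Equiv.Perm (Fin n) => ∑ i, A i (σ i)) (by simp [hs])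
  by_cases hb : detp A = ⊥
  · apply gm_of_det_zero A (Matrix.of fun i j => gmT (A i j)) (fun i j => ⟨gmT_nonneg _, gmw_gmT _⟩)
    rw [← Matrix.det_transpose, Matrix.det_apply']
    apply Finset.sum_eq_zero
    intro τ _
    have : ∏ i, gmT (A i (τ i)) = 0 := by
      have h0 : ∑ i, A i (τ i) = ⊥ := le_bot_iff.mp ((hle τ).trans hb.le)
      rw [← gmT_sum, h0, gmT_bot]
    simp [this]
  · have ex : ∀ s : Finset (Equiv.Perm (Fin n)), (s.sup fun σ => ∑ i, A i (σ i)) ≠ ⊥ →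
        ∃ σ ∈ s, (s.sup fun σ => ∑ i, A i (σ i)) = ∑ i, A i (σ i) := by
      intro s hs
      apply Finset.exists_mem_eq_sup
      by_contra hne
      rw [Finset.not_nonempty_iff_eq_empty] at hne
      subst hne; simp at hs
    obtain ⟨σ, hσ, hσe⟩ := ex _ hb
    obtain ⟨τ, hτ, hτe⟩ := ex _ (h ▸ hb : detm A ≠ ⊥)
    have hσs : Equiv.Perm.sign σ = 1 := by simpa using hσ
    have hτs : Equiv.Perm.sign τ = -1 := by simpa using hτ
    obtain ⟨M, hM, hMd⟩ := gm_lift A σ fun ρ => (hle ρ).trans hσe.le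
    obtain ⟨N, hN, hNd⟩ := gm_lift A τ fun ρ => (hle ρ).trans (h.le.trans hτe.le)
    rw [hσs] at hMd
    rw [hτs] at hNd
    obtain ⟨P, hP, hPd⟩ := gm_zero_det A M N hM hN (by simpa using hMd) (by simpa using hNd)
    exact gm_of_det_zero A P hP hPd

lemma gm_cycle {n : ℕ} (f : Fin n → Fin n) (S : Fin n → Prop) (c : Fin n → Prop)
    (hS : ∀ k, S k → S (f k)) (hc : ∀ k, S k → (c (f k) ↔ ¬ c k)) (k0 : Fin n) (hk0 : S k0) :
    ∃ π : Equiv.Perm (Fin n), Equiv.Perm.sign π = -1 ∧ ∀ k, π k = k ∨ (S k ∧ π k = f k) := by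
  obtain ⟨x, hxS, hx⟩ : ∃ x, S x ∧ x ∈ Function.periodicPts f := by
    have hit : ∀ m, S (f^[m] k0) := by
      intro m
      induction m with
      | zero => exact hk0
      | succ m ih => rw [Function.iterate_succ_apply']; exact hS _ ih
    obtain ⟨a, b, hab, he⟩ := Finite.exists_ne_map_eq_of_infinite (fun m : ℕ => f^[m] k0)
    wlog hlt : a < b generalizing a b
    · exact this b a hab.symm he.symm (by omega)
    refine ⟨f^[a] k0, hit a, Function.mk_mem_periodicPts (n := b - a) (by omega) ?_⟩
    change f^[b - a] (f^[a] k0) = f^[a] k0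
    rw [← Function.iterate_add_apply, Nat.sub_add_cancel hlt.le]
    exact he.symm
  have hit : ∀ m, S (f^[m] x) := by
    intro m
    induction m with
    | zero => exact hxS
    | succ m ih => rw [Function.iterate_succ_apply']; exact hS _ ih
  have hpar : ∀ m, (c (f^[m] x) ↔ (c x ↔ Even m)) := by
    intro m
    induction m with
    | zero => simp
    | succ m ih =>
      rw [Function.iterate_succ_apply', hc _ (hit m), ih, Nat.even_add_one]
      tauto
  set p := Function.minimalPeriod f x with hp
  have hp0 : 0 < p := Function.minimalPeriod_pos_of_mem_periodicPts hx
  have hpe : Even p := by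
    have h1 := hpar p
    rw [hp, Function.iterate_minimalPeriod, ← hp] at h1
    tauto
  have hp2 : 2 ≤ p := by
    rcases hpe with ⟨r, hr⟩; omega
  let l : List (Fin n) := (List.range p).map fun m => f^[m] x
  have hlen : l.length = p := by simp [l]
  have hnd : l.Nodup := by
    have := Function.nodup_periodicOrbit (f := f) (x := x)
    rwa [Function.periodicOrbit, Cycle.nodup_coe_iff] at this
  refine ⟨l.formPerm, ?_, ?_⟩
  · rw [(List.isCycle_formPerm hnd (by omega)).sign, List.support_formPerm_of_nodup l hnd,
      List.toFinset_card_of_nodup hnd, hlen, hpe.neg_one_pow]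
    rintro y hy
    rw [hy] at hlen
    simp at hlen; omega
  · intro k
    by_cases hk : k ∈ l
    · right
      obtain ⟨m, hm, rfl⟩ := List.mem_iff_getElem.mp hk
      have hlm : ∀ (m : ℕ) (hm : m < l.length), l[m] = f^[m] x := by
        intro m hm; simp [l]
      rw [List.formPerm_apply_getElem l hnd m hm, hlm, hlm, hlen]
      refine ⟨hit m, ?_⟩
      rw [hp, Function.iterate_mod_minimalPeriod_eq, Function.iterate_succ_apply']
    · left
      exact List.formPerm_apply_of_notMem hk

lemma gm_swap {n : ℕ} (A : Matrix (Fin n) (Fin n) (WithBot ℝ))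
    (I : Finset (Fin n)) (α : Fin n → WithBot ℝ) (hα : ∃ k, α k ≠ ⊥)
    (h : ∀ i, (I.sup fun k => α k + A i k) = (Iᶜ.sup fun k => α k + A i k))
    (σ : Equiv.Perm (Fin n)) (hσ : ∑ i, A i (σ i) ≠ ⊥) :
    ∃ τ : Equiv.Perm (Fin n), Equiv.Perm.sign τ = - Equiv.Perm.sign σ ∧
      ∑ i, A i (σ i) ≤ ∑ i, A i (τ i) := by
  have hfin : ∀ i, A i (σ i) ≠ ⊥ := by
    intro i hi
    apply hσ
    rw [← Finset.add_sum_erase _ _ (Finset.mem_univ i), hi, WithBot.bot_add]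
  have hex : ∀ k, ∃ k', α k ≠ ⊥ → ((k' ∈ I ↔ ¬ k ∈ I) ∧
      α k + A (σ.symm k) k ≤ α k' + A (σ.symm k) k') := by
    intro k
    by_cases hk : α k = ⊥
    · exact ⟨k, fun h => absurd hk h⟩
    have hA : A (σ.symm k) k ≠ ⊥ := by simpa using hfin (σ.symm k)
    have hlt : ⊥ < α k + A (σ.symm k) k := by
      rw [bot_lt_iff_ne_bot]
      simp [WithBot.add_eq_bot, hk, hA]
    by_cases hkI : k ∈ I
    · have h1 : α k + A (σ.symm k) k ≤ Iᶜ.sup fun j => α j + A (σ.symm k) j := by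
        rw [← h]; exact Finset.le_sup (f := fun j => α j + A (σ.symm k) j) hkI
      obtain ⟨k', hk', hle⟩ := (Finset.le_sup_iff hlt).mp h1
      exact ⟨k', fun _ => ⟨by simp at hk'; tauto, hle⟩⟩
    · have h1 : α k + A (σ.symm k) k ≤ I.sup fun j => α j + A (σ.symm k) j := by
        rw [h]; exact Finset.le_sup (f := fun j => α j + A (σ.symm k) j) (by simpa using hkI)
      obtain ⟨k', hk', hle⟩ := (Finset.le_sup_iff hlt).mp h1
      exact ⟨k', fun _ => ⟨by tauto, hle⟩⟩
  choose f hf using hex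
  obtain ⟨k0, hk0⟩ := hα
  have hS : ∀ k, α k ≠ ⊥ → α (f k) ≠ ⊥ := by
    intro k hk hb
    have h1 := (hf k hk).2
    rw [hb, WithBot.bot_add, le_bot_iff, WithBot.add_eq_bot] at h1
    have hA : A (σ.symm k) k ≠ ⊥ := by simpa using hfin (σ.symm k)
    tauto
  obtain ⟨π, hπ, hπf⟩ := gm_cycle f (fun k => α k ≠ ⊥) (fun k => k ∈ I) hS
    (fun k hk => (hf k hk).1) k0 hk0
  refine ⟨π * σ, by simp [hπ], ?_⟩
  let a : Fin n → ℝ := fun k => (α k).unbotD 0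
  have ha : ∀ k, α k ≠ ⊥ → α k = (a k : WithBot ℝ) := by
    intro k hk
    obtain ⟨r, hr⟩ := WithBot.ne_bot_iff_exists.mp hk
    simp [a, ← hr]
  have hrow : ∀ i, (a (σ i) : WithBot ℝ) + A i (σ i) ≤ (a (π (σ i)) : WithBot ℝ) + A i (π (σ i)) := by
    intro i
    rcases hπf (σ i) with he | ⟨hk, he⟩
    · rw [he]
    · have := (hf _ hk).2
      rw [ha _ hk, ha _ (hS _ hk), Equiv.symm_apply_apply] at this
      rw [he]; exact this
  have hsum := Finset.sum_le_sum fun i (_ : i ∈ Finset.univ) => hrow i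
  rw [Finset.sum_add_distrib, Finset.sum_add_distrib,
    Equiv.sum_comp σ (fun k => (a k : WithBot ℝ)),
    Equiv.sum_comp σ (fun k => (a (π k) : WithBot ℝ)),
    Equiv.sum_comp π (fun k => (a k : WithBot ℝ))] at hsum
  have hc : (∑ k, (a k : WithBot ℝ)) = ((∑ k, a k : ℝ) : WithBot ℝ) := by
    simp
  rw [hc] at hsum
  exact (WithBot.add_le_add_iff_left WithBot.coe_ne_bot).mp hsum

/-- **Gondran–Minoux theorem**: `|A|⁺ = |A|⁻` iff the columns of `A` are linearly
dependent in the Gondran–Minoux sense, i.e. there are a partition of the column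
indices into `I` and its complement, and scalars `α` not all `-∞`, such that
`⊕_{k∈I} α_k ⊙ A_k = ⊕_{k∈Iᶜ} α_k ⊙ A_k` (entrywise, i.e. for every row `i`). -/
theorem gondran_minoux {n : ℕ} (A : Matrix (Fin n) (Fin n) (WithBot ℝ)) :
    detp A = detm A ↔
    ∃ (I : Finset (Fin n)) (α : Fin n → WithBot ℝ),
      (∃ k, α k ≠ ⊥) ∧
      ∀ i, (I.sup fun k => α k + A i k) = (Iᶜ.sup fun k => α k + A i k) := by
  constructor
  · exact gm_forward A
  · rintro ⟨I, α, hα, h⟩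
    apply le_antisymm
    · apply Finset.sup_le
      intro σ hσ
      have hσs : Equiv.Perm.sign σ = 1 := by simpa using hσ
      by_cases hb : ∑ i, A i (σ i) = ⊥
      · rw [hb]; exact bot_le
      obtain ⟨τ, hτ, hle⟩ := gm_swap A I α hα h σ hb
      exact hle.trans (Finset.le_sup (f := fun σ : Equiv.Perm (Fin n) => ∑ i, A i (σ i))
        (by simp [hτ, hσs]))
    · apply Finset.sup_le
      intro σ hσ
      have hσs : Equiv.Perm.sign σ = -1 := by simpa using hσ
      by_cases hb : ∑ i, A i (σ i) = ⊥
      · rw [hb]; exact bot_le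
      obtain ⟨τ, hτ, hle⟩ := gm_swap A I α hα h σ hb
      exact hle.trans (Finset.le_sup (f := fun σ : Equiv.Perm (Fin n) => ∑ i, A i (σ i))
        (by simp [hτ, hσs]))
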